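/- Let Ω ⊂ ℝ^m be a bounded open set with smooth boundary, let k ≥ 1 be an integer and let α ∈ (0,1) with αk < 1. Then there exists a constant C > 0 such that every continuous function f on cl Ω vanishing on ∂Ω for which N := sup_{s>0} s^{−α} K(s, f; C̃^0(cl Ω), C̃^k(cl Ω)) is finite belongs to C̃^{αk}(cl Ω) and satisfies ‖f‖_{C^{αk}(cl Ω)} ≤ C N. In other words, (C̃^0(cl Ω), C̃^k(cl Ω))_{α,∞} ⊂ C̃^{αk}(cl Ω) continuously. -/

import Mathlib

open Set

noncomputable section

/-- `Ω` has smooth boundary: near every boundary point, `Ω` is the sublevel set of a smooth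
function with non-vanishing differential. -/
def HasSmoothBoundary {E : Type*} [NormedAddCommGroup E] [NormedSpace ℝ E] (Ω : Set E) : Prop :=
  ∀ x ∈ frontier Ω, ∃ (U : Set E) (φ : E → ℝ), IsOpen U ∧ x ∈ U ∧ ContDiff ℝ (⊤ : ℕ∞) φ ∧
    (∀ y ∈ U, fderiv ℝ φ y ≠ 0) ∧ Ω ∩ U = {y ∈ U | φ y < 0}

/-- `f` belongs to `C^t(s)`: it is `C^⌊t⌋` on `s`, with bounded derivatives of order `≤ ⌊t⌋`,
and the order-`⌊t⌋` derivative is `(t - ⌊t⌋)`-Hölder continuous on `s`. -/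
def MemCt {E : Type*} [NormedAddCommGroup E] [NormedSpace ℝ E]
    (t : ℝ) (s : Set E) (f : E → ℝ) : Prop :=
  ContDiffOn ℝ (⌊t⌋₊ : ℕ) f s ∧
  (∃ C : ℝ, ∀ i : ℕ, (i : ℝ) ≤ t → ∀ x ∈ s, ‖iteratedFDerivWithin ℝ i f s x‖ ≤ C) ∧
  (∃ C : ℝ, ∀ x ∈ s, ∀ y ∈ s,
    ‖iteratedFDerivWithin ℝ ⌊t⌋₊ f s x - iteratedFDerivWithin ℝ ⌊t⌋₊ f s y‖
      ≤ C * ‖x - y‖ ^ (t - (⌊t⌋₊ : ℝ)))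

/-- The `C^t` norm on a set `s`. -/
def ctNorm {E : Type*} [NormedAddCommGroup E] [NormedSpace ℝ E]
    (t : ℝ) (s : Set E) (f : E → ℝ) : ℝ :=
  max (sSup {r : ℝ | ∃ i : ℕ, (i : ℝ) ≤ t ∧ ∃ x ∈ s, r = ‖iteratedFDerivWithin ℝ i f s x‖})
      (sSup {r : ℝ | ∃ x ∈ s, ∃ y ∈ s, x ≠ y ∧
        r = ‖iteratedFDerivWithin ℝ ⌊t⌋₊ f s x - iteratedFDerivWithin ℝ ⌊t⌋₊ f s y‖
              / ‖x - y‖ ^ (t - (⌊t⌋₊ : ℝ))})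

/-- `f ∈ C̃^t(cl Ω)`: `f ∈ C^t(cl Ω)` and `f` vanishes on `∂Ω`. -/
def MemCtTilde {E : Type*} [NormedAddCommGroup E] [NormedSpace ℝ E]
    (t : ℝ) (Ω : Set E) (f : E → ℝ) : Prop :=
  MemCt t (closure Ω) f ∧ ∀ x ∈ frontier Ω, f x = 0

/-- The K-functional `K(s, f; C̃^{t₀}(cl Ω), C̃^{t₁}(cl Ω))`. -/
def kFunctional {E : Type*} [NormedAddCommGroup E] [NormedSpace ℝ E]
    (s : ℝ) (t₀ t₁ : ℝ) (Ω : Set E) (f : E → ℝ) : ℝ :=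
  sInf {r : ℝ | ∃ f₀ f₁ : E → ℝ, (∀ x ∈ closure Ω, f x = f₀ x + f₁ x) ∧
    MemCtTilde t₀ Ω f₀ ∧ MemCtTilde t₁ Ω f₁ ∧
    r = ctNorm t₀ (closure Ω) f₀ + s * ctNorm t₁ (closure Ω) f₁}



theorem exists_coeff_sum_mul_natCast_pow (k : ℕ) :
    ∃ c : ℕ → ℝ, ∀ j < k, ∑ i ∈ Finset.range k, c i * (i : ℝ) ^ j = if j = 1 then 1 else 0 := by
  classical
  refine ⟨fun i ↦ (Lagrange.basis (Finset.range k) (fun n : ℕ ↦ (n : ℝ)) i).derivative.eval 0,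
    fun j hj ↦ ?_⟩
  have h := Lagrange.eq_interpolate (s := Finset.range k) (v := fun n : ℕ ↦ (n : ℝ))
    (f := (Polynomial.X ^ j : Polynomial ℝ)) Nat.cast_injective.injOn
    (by rw [Polynomial.degree_X_pow, Finset.card_range]; exact_mod_cast hj)
  have h' := congrArg (fun p : Polynomial ℝ ↦ p.derivative.eval 0) h
  simp only [Lagrange.interpolate_apply, Polynomial.derivative_sum, Polynomial.eval_finsetSum,
    Polynomial.derivative_C_mul, Polynomial.eval_mul, Polynomial.eval_C, Polynomial.eval_pow,
    Polynomial.eval_X, Polynomial.derivative_X_pow] at h'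
  simp_rw [mul_comm _ ((_ : ℝ) ^ j)]
  rw [← h']
  rcases j with _ | _ | j <;> simp

theorem exists_abs_deriv_le (n : ℕ) (hn : 1 ≤ n) :
    ∃ c > 0, ∀ (u : ℝ → ℝ) (η A B : ℝ), 0 < η →
      (∀ t ∈ Icc 0 η, ContDiffAt ℝ (n + 1 : ℕ) u t) → (∀ t ∈ Icc 0 η, |u t| ≤ A) →
      (∀ t ∈ Icc 0 η, |iteratedDeriv (n + 1) u t| ≤ B) →
      |deriv u 0| ≤ c * (A / η + η ^ n * B) := by
  obtain ⟨c, hc⟩ := exists_coeff_sum_mul_natCast_pow (n + 1)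
  set S : ℝ := ∑ i ∈ Finset.range (n + 1), |c i| with hS
  have hS0 : 0 ≤ S := Finset.sum_nonneg fun _ _ ↦ abs_nonneg _
  refine ⟨(n + 1) * (S + 1), by positivity, fun u η A B hη hu hA hB ↦ ?_⟩
  have h0 : (0 : ℝ) ∈ Icc 0 η := ⟨le_rfl, hη.le⟩
  have hA0 : 0 ≤ A := (abs_nonneg _).trans (hA 0 h0)
  have hB0 : 0 ≤ B := (abs_nonneg _).trans (hB 0 h0)
  have hn0 : (0 : ℝ) < n := by exact_mod_cast hn
  have hU := uniqueDiffOn_Icc hη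
  set a : ℕ → ℝ := fun j ↦ (j.factorial : ℝ)⁻¹ * iteratedDeriv j u 0 with ha
  set p : ℝ → ℝ := fun t ↦ ∑ j ∈ Finset.range (n + 1), a j * t ^ j with hp
  have hT : ∀ t ∈ Icc 0 η, |u t - p t| ≤ B * η ^ (n + 1) := by
    intro t ht
    have key := taylor_mean_remainder_bound (f := u) (n := n) (C := B) hη.le
      (fun x hx ↦ by exact_mod_cast (hu x hx).contDiffWithinAt) ht (fun y hy ↦ by
        rw [iteratedDerivWithin_eq_iteratedDeriv hU (hu y hy) hy]; exact hB y hy)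
    have hpt : taylorWithinEval u n (Icc 0 η) 0 t = p t := by
      rw [taylor_within_apply]
      refine Finset.sum_congr rfl fun j hj ↦ ?_
      rw [iteratedDerivWithin_eq_iteratedDeriv hU ((hu 0 h0).of_le ?_) h0]
      · simp only [ha, sub_zero, smul_eq_mul]; ring
      · exact_mod_cast (Finset.mem_range.1 hj).le
    rw [hpt, sub_zero, Real.norm_eq_abs] at key
    refine key.trans ((div_le_self (mul_nonneg hB0 (pow_nonneg ht.1 _)) ?_).trans ?_)
    · exact_mod_cast n.factorial_pos
    · gcongr
      exacts [ht.1, ht.2]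
  set δ : ℝ := η / (n + 1) with hδ
  have hδ0 : 0 < δ := by positivity
  have hmem : ∀ i ∈ Finset.range (n + 1), (i : ℝ) * δ ∈ Icc 0 η := by
    intro i hi
    have : (i : ℝ) ≤ n + 1 := by exact_mod_cast (Finset.mem_range.1 hi).le
    refine ⟨by positivity, ?_⟩
    rw [hδ, mul_div_assoc', div_le_iff₀ (by positivity), mul_comm]
    gcongr
  have hsum : ∑ i ∈ Finset.range (n + 1), c i * p (i * δ) = δ * deriv u 0 := by
    simp only [hp, Finset.mul_sum]
    rw [Finset.sum_comm]
    have : ∀ j ∈ Finset.range (n + 1),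
        ∑ i ∈ Finset.range (n + 1), c i * (a j * ((i : ℝ) * δ) ^ j)
          = if j = 1 then a 1 * δ else 0 := by
      intro j hj
      have := hc j (Finset.mem_range.1 hj)
      calc _ = a j * δ ^ j * ∑ i ∈ Finset.range (n + 1), c i * (i : ℝ) ^ j := by
            rw [Finset.mul_sum]; refine Finset.sum_congr rfl fun i _ ↦ ?_; ring
        _ = _ := by rw [this]; split_ifs with h <;> simp [h]
    rw [Finset.sum_congr rfl this, Finset.sum_ite_eq' ]
    simp [ha, iteratedDeriv_one, Nat.pos_of_ne_zero (by omega : n ≠ 0), mul_comm]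
  have hmain : δ * |deriv u 0| ≤ S * (A + B * η ^ (n + 1)) := by
    rw [show δ * |deriv u 0| = |δ * deriv u 0| by rw [abs_mul, abs_of_pos hδ0], ← hsum, hS, Finset.sum_mul]
    refine (Finset.abs_sum_le_sum_abs _ _).trans (Finset.sum_le_sum fun i hi ↦ ?_)
    rw [abs_mul]
    gcongr
    have h1 := hT _ (hmem i hi)
    have h2 := hA _ (hmem i hi)
    rw [abs_le] at *
    constructor <;> linarith [h1.1, h1.2, h2.1, h2.2]
  have h3 : |deriv u 0| ≤ (n + 1) * (S * (A / η + η ^ n * B)) := by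
    rw [← mul_le_mul_iff_right₀ hδ0]
    refine hmain.trans (le_of_eq ?_)
    rw [hδ]
    field_simp
    ring
  refine h3.trans ?_
  rw [mul_assoc]
  gcongr
  linarith

section

variable {E : Type*} [NormedAddCommGroup E] [NormedSpace ℝ E]

theorem contDiffAt_comp_line {n : ℕ} {Ω : Set E} (hΩ : IsOpen Ω) {g : E → ℝ}
    (hg : ContDiffOn ℝ n g Ω) {x w : E} {t : ℝ} (ht : x + t • w ∈ Ω) :
    ContDiffAt ℝ n (fun t : ℝ ↦ g (x + t • w)) t :=
  (hg.contDiffAt (hΩ.mem_nhds ht)).comp t (f := fun t : ℝ ↦ x + t • w) (by fun_prop)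

theorem abs_iteratedDeriv_comp_line_le {n : ℕ} {Ω : Set E} (hΩ : IsOpen Ω) {g : E → ℝ}
    (hg : ContDiffOn ℝ n g Ω) {x w : E} {t : ℝ} (ht : x + t • w ∈ Ω) :
    |iteratedDeriv n (fun t : ℝ ↦ g (x + t • w)) t|
      ≤ ‖iteratedFDeriv ℝ n g (x + t • w)‖ * ‖w‖ ^ n := by
  set s : Set E := (fun z ↦ x + z) ⁻¹' Ω
  have hs : IsOpen s := hΩ.preimage (by fun_prop)
  set L : ℝ →L[ℝ] E := ContinuousLinearMap.toSpanSingleton ℝ w with hL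
  have hG : ContDiffOn ℝ n (fun z ↦ g (x + z)) s :=
    hg.comp (g := g) (f := fun z ↦ x + z) (by fun_prop) (fun z hz ↦ hz)
  have hs' : IsOpen (L ⁻¹' s) := hs.preimage L.continuous
  have hts : L t ∈ s := by simpa [s, L] using ht
  have h := L.iteratedFDerivWithin_comp_right hG hs.uniqueDiffOn hs'.uniqueDiffOn hts
    (i := n) le_rfl
  rw [iteratedFDerivWithin_of_isOpen n hs' hts, iteratedFDerivWithin_of_isOpen n hs hts,
    iteratedFDeriv_comp_add_left] at h
  have hfun : (fun z ↦ g (x + z)) ∘ L = fun t : ℝ ↦ g (x + t • w) := by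
    ext; simp [L]
  rw [hfun] at h
  rw [← Real.norm_eq_abs, ← norm_iteratedFDeriv_eq_norm_iteratedDeriv, h]
  refine (ContinuousMultilinearMap.norm_compContinuousLinearMap_le _ _).trans ?_
  simp [L, ContinuousLinearMap.norm_toSpanSingleton]

/-- The uniform interior cone property, near a point of the closure. -/
theorem HasSmoothBoundary.exists_cone {Ω : Set E} (hΩ : IsOpen Ω) (hs : HasSmoothBoundary Ω)
    {x : E} (hx : x ∈ closure Ω) :
    ∃ W ∈ nhds x, ∃ v : E, ∃ ε > 0, ∃ r > 0, ∀ y ∈ W ∩ Ω, ∀ w ∈ Metric.closedBall v ε,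
      ∀ τ ∈ Icc (0 : ℝ) r, y + τ • w ∈ Ω := by
  by_cases hxΩ : x ∈ Ω
  · have hev : ∀ᶠ p : E × E × ℝ in nhds (x, 0, 0), p.1 + p.2.2 • p.2.1 ∈ Ω := by
      have : Continuous fun p : E × E × ℝ ↦ p.1 + p.2.2 • p.2.1 := by fun_prop
      exact this.continuousAt.eventually_mem (hΩ.mem_nhds (by simpa using hxΩ))
    obtain ⟨δ, hδ, hball⟩ := Metric.eventually_nhds_iff_ball.1 hev
    refine ⟨_, Metric.ball_mem_nhds x hδ, 0, δ / 2, half_pos hδ, δ / 2, half_pos hδ,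
      fun y hy w hw τ hτ ↦ hball (y, w, τ) ?_⟩
    have := Metric.mem_closedBall.1 hw
    simp only [Metric.mem_ball, Prod.dist_eq, max_lt_iff, Real.dist_eq, sub_zero,
      abs_of_nonneg hτ.1]
    exact ⟨hy.1, by linarith, by linarith [hτ.2]⟩
  · obtain ⟨U, φ, hU, hxU, hφ, hd, hΩU⟩ := hs x (by
      rw [frontier, hΩ.interior_eq]; exact ⟨hx, hxΩ⟩)
    obtain ⟨v, hv⟩ : ∃ v, fderiv ℝ φ x v < 0 := by
      obtain ⟨v, hv⟩ := DFunLike.ne_iff.1 (hd x hxU)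
      rcases lt_or_gt_of_ne hv with h | h
      · exact ⟨v, h⟩
      · exact ⟨-v, by simpa using h⟩
    have hev : ∀ᶠ p : E × E × ℝ in nhds (x, v, 0), p.1 + p.2.2 • p.2.1 ∈ U ∧
        fderiv ℝ φ (p.1 + p.2.2 • p.2.1) p.2.1 < 0 := by
      have h1 : Continuous fun p : E × E × ℝ ↦ p.1 + p.2.2 • p.2.1 := by fun_prop
      have h2 : Continuous fun p : E × E × ℝ ↦ fderiv ℝ φ (p.1 + p.2.2 • p.2.1) p.2.1 :=
        ((hφ.continuous_fderiv (by simp)).comp h1).clm_apply (by fun_prop)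
      exact (h1.continuousAt.eventually_mem (hU.mem_nhds (by simpa using hxU))).and
        (h2.continuousAt.eventually_lt continuousAt_const (by simpa using hv))
    obtain ⟨δ, hδ, hball⟩ := Metric.eventually_nhds_iff_ball.1 hev
    refine ⟨_, Metric.ball_mem_nhds x hδ, v, δ / 2, half_pos hδ, δ / 2, half_pos hδ,
      fun y hy w hw τ hτ ↦ ?_⟩
    have hmem : ∀ σ ∈ Icc (0 : ℝ) (δ / 2), y + σ • w ∈ U ∧ fderiv ℝ φ (y + σ • w) w < 0 := by
      intro σ hσ
      refine hball (y, w, σ) ?_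
      have := Metric.mem_closedBall.1 hw
      simp only [Metric.mem_ball, Prod.dist_eq, max_lt_iff, Real.dist_eq, sub_zero,
        abs_of_nonneg hσ.1]
      exact ⟨hy.1, by linarith, by linarith [hσ.2]⟩
    have hder : ∀ σ : ℝ, HasDerivAt (fun σ : ℝ ↦ φ (y + σ • w)) (fderiv ℝ φ (y + σ • w) w) σ := by
      intro σ
      have h1 : HasFDerivAt φ (fderiv ℝ φ (y + σ • w)) (y + σ • w) :=
        (hφ.differentiable (by simp) _).hasFDerivAt
      have h2 : HasDerivAt (fun σ : ℝ ↦ y + σ • w) w σ := by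
        simpa using ((hasDerivAt_id σ).smul_const w).const_add y
      exact h1.comp_hasDerivAt σ h2
    have hanti : AntitoneOn (fun σ : ℝ ↦ φ (y + σ • w)) (Icc 0 (δ / 2)) := by
      refine antitoneOn_of_deriv_nonpos (convex_Icc _ _)
        (fun σ _ ↦ (hder σ).continuousAt.continuousWithinAt)
        (fun σ _ ↦ (hder σ).differentiableAt.differentiableWithinAt) fun σ hσ ↦ ?_
      rw [(hder σ).deriv]
      exact (hmem σ (interior_subset hσ)).2.le
    have h0 : (0 : ℝ) ∈ Icc 0 (δ / 2) := ⟨le_rfl, (half_pos hδ).le⟩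
    have hle := hanti h0 hτ hτ.1
    have hy0 : y ∈ Ω ∩ U := ⟨hy.2, by simpa using (hmem 0 h0).1⟩
    rw [hΩU] at hy0
    have : y + τ • w ∈ {y ∈ U | φ y < 0} :=
      ⟨(hmem τ hτ).1, lt_of_le_of_lt (by simpa using hle) hy0.2⟩
    rw [← hΩU] at this
    exact this.1

theorem norm_le_of_forall_mem_closedBall (T : E →L[ℝ] ℝ) {v : E} {ε M : ℝ} (hε : 0 < ε)
    (h : ∀ w ∈ Metric.closedBall v ε, |T w| ≤ M) : ‖T‖ ≤ 2 / ε * M := by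
  have hv := h v (Metric.mem_closedBall_self hε.le)
  have hM : 0 ≤ M := (abs_nonneg _).trans hv
  refine T.opNorm_le_bound (by positivity) fun z ↦ ?_
  rcases eq_or_ne z 0 with rfl | hz
  · simp
  have hz' : 0 < ‖z‖ := norm_pos_iff.2 hz
  have hw := h (v + (ε / ‖z‖) • z) (by
    simp only [Metric.mem_closedBall, dist_eq_norm, add_sub_cancel_left, norm_smul, norm_div,
      abs_norm, Real.norm_eq_abs, abs_of_pos hε]
    rw [div_mul_cancel₀ _ hz'.ne'])
  have hb : |ε / ‖z‖ * T z| ≤ 2 * M := by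
    rw [map_add, map_smul, smul_eq_mul] at hw
    rw [abs_le] at *
    constructor <;> linarith [hv.1, hv.2, hw.1, hw.2]
  rw [abs_mul, abs_of_pos (by positivity), div_mul_eq_mul_div, div_le_iff₀ hz'] at hb
  rw [Real.norm_eq_abs, div_mul_eq_mul_div, div_mul_eq_mul_div, le_div_iff₀ hε]
  linarith

/-- Interpolation of the gradient between the sup norm and the derivative of order `n + 1`. -/
theorem exists_norm_fderiv_le [ProperSpace E] {Ω : Set E} (hΩ : IsOpen Ω)
    (hb : Bornology.IsBounded Ω) (hs : HasSmoothBoundary Ω) (n : ℕ) :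
    ∃ C > 0, ∀ (g : E → ℝ) (A B h : ℝ), ContDiffOn ℝ (n + 1 : ℕ) g Ω → (∀ x ∈ Ω, |g x| ≤ A) →
      (∀ x ∈ Ω, ‖iteratedFDeriv ℝ (n + 1) g x‖ ≤ B) → 0 < h → h ≤ 1 →
      ∀ x ∈ Ω, ‖fderiv ℝ g x‖ ≤ C * (A / h + h ^ n * B) := by
  rcases Nat.eq_zero_or_pos n with rfl | hn
  · refine ⟨1, one_pos, fun g A B h _ hA hB hh _ x hx ↦ ?_⟩
    have h1 := hB x hx
    rw [zero_add, norm_iteratedFDeriv_one] at h1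
    have : 0 ≤ A / h := div_nonneg ((abs_nonneg _).trans (hA x hx)) hh.le
    simpa using by linarith
  obtain ⟨c, hc, hc1⟩ := exists_abs_deriv_le n hn
  let P : Set E → Prop := fun S ↦ ∃ C > 0, ∀ (g : E → ℝ) (A B h : ℝ),
    ContDiffOn ℝ (n + 1 : ℕ) g Ω → (∀ x ∈ Ω, |g x| ≤ A) →
    (∀ x ∈ Ω, ‖iteratedFDeriv ℝ (n + 1) g x‖ ≤ B) → 0 < h → h ≤ 1 →
    ∀ x ∈ S ∩ Ω, ‖fderiv ℝ g x‖ ≤ C * (A / h + h ^ n * B)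
  have hP : P (closure Ω) := by
    refine hb.isCompact_closure.induction_on (p := P) ⟨1, one_pos, by simp⟩ ?_ ?_ ?_
    · rintro S T hST ⟨C, hC, H⟩
      exact ⟨C, hC, fun g A B h hg hA hB h0 h1 x hx ↦ H g A B h hg hA hB h0 h1 x ⟨hST hx.1, hx.2⟩⟩
    · rintro S T ⟨C, hC, H⟩ ⟨C', hC', H'⟩
      refine ⟨C + C', by positivity, fun g A B h hg hA hB h0 h1 x hx ↦ ?_⟩
      have hpos : 0 ≤ A / h + h ^ n * B := by
        have := (abs_nonneg _).trans (hA x hx.2)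
        have := (norm_nonneg _).trans (hB x hx.2)
        positivity
      rcases hx with ⟨hx | hx, hxΩ⟩
      · refine (H g A B h hg hA hB h0 h1 x ⟨hx, hxΩ⟩).trans ?_
        gcongr; linarith
      · refine (H' g A B h hg hA hB h0 h1 x ⟨hx, hxΩ⟩).trans ?_
        gcongr; linarith
    · intro x₀ hx₀
      obtain ⟨W, hW, v, ε, hε, r, hr, hcone⟩ := hs.exists_cone hΩ hx₀
      refine ⟨W, mem_nhdsWithin_of_mem_nhds hW,
        2 / ε * (c * (1 / r + r ^ n * (‖v‖ + ε) ^ (n + 1))), by positivity,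
        fun g A B h hg hA hB h0 h1 x hx ↦ ?_⟩
      have hA0 := (abs_nonneg _).trans (hA x hx.2)
      have hB0 := (norm_nonneg _).trans (hB x hx.2)
      rw [mul_assoc (2 / ε)]
      refine norm_le_of_forall_mem_closedBall (v := v) _ hε fun w hw ↦ ?_
      have hwn : ‖w‖ ≤ ‖v‖ + ε := by
        have := norm_le_norm_add_norm_sub' w v
        have := mem_closedBall_iff_norm.1 hw
        linarith
      have hin : ∀ t ∈ Icc 0 (r * h), x + t • w ∈ Ω := fun t ht ↦
        hcone x hx w hw t ⟨ht.1, ht.2.trans (mul_le_of_le_one_right hr.le h1)⟩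
      have key := hc1 (fun t ↦ g (x + t • w)) (r * h) A (B * (‖v‖ + ε) ^ (n + 1)) (by positivity)
        (fun t ht ↦ contDiffAt_comp_line hΩ hg (hin t ht)) (fun t ht ↦ hA _ (hin t ht))
        (fun t ht ↦ (abs_iteratedDeriv_comp_line_le hΩ hg (hin t ht)).trans (by
          gcongr; exact hB _ (hin t ht)))
      have hder : deriv (fun t : ℝ ↦ g (x + t • w)) 0 = fderiv ℝ g x w := by
        have h1 : HasFDerivAt g (fderiv ℝ g x) (x + (0 : ℝ) • w) := by
          rw [zero_smul, add_zero]
          exact ((hg.contDiffAt (hΩ.mem_nhds hx.2)).differentiableAt (by simp)).hasFDerivAt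
        have h2 : HasDerivAt (fun σ : ℝ ↦ x + σ • w) w 0 := by
          simpa using ((hasDerivAt_id (0 : ℝ)).smul_const w).const_add x
        exact (h1.comp_hasDerivAt (0 : ℝ) h2).deriv
      rw [hder] at key
      refine key.trans ?_
      rw [mul_assoc c]
      refine mul_le_mul_of_nonneg_left ?_ hc.le
      have e1 : A / (r * h) = 1 / r * (A / h) := by field_simp
      have e2 : (r * h) ^ n * (B * (‖v‖ + ε) ^ (n + 1))
          = r ^ n * (‖v‖ + ε) ^ (n + 1) * (h ^ n * B) := by rw [mul_pow]; ring
      rw [e1, e2, add_mul]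
      gcongr
      · exact le_add_of_nonneg_right (by positivity)
      · exact le_add_of_nonneg_left (by positivity)
  obtain ⟨C, hC, H⟩ := hP
  exact ⟨C, hC, fun g A B h hg hA hB h0 h1 x hx ↦
    H g A B h hg hA hB h0 h1 x ⟨subset_closure hx, hx⟩⟩

theorem abs_sub_le_mul_dist_of_openSegment {Ω : Set E} {b : E → ℝ} {L : ℝ}
    (hbc : ContinuousOn b (closure Ω)) (hbd : ∀ x ∈ Ω, DifferentiableAt ℝ b x)
    (hbL : ∀ x ∈ Ω, ‖fderiv ℝ b x‖ ≤ L) {x y : E} (hx : x ∈ closure Ω) (hy : y ∈ closure Ω)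
    (hxy : ∀ t ∈ Ioo (0 : ℝ) 1, x + t • (y - x) ∈ Ω) : |b x - b y| ≤ L * dist x y := by
  have hcl : ∀ t ∈ Icc (0 : ℝ) 1, x + t • (y - x) ∈ closure Ω := by
    rintro t ⟨h0, h1⟩
    rcases h0.eq_or_lt with rfl | h0
    · simpa using hx
    rcases h1.eq_or_lt with rfl | h1
    · simpa using hy
    · exact subset_closure (hxy t ⟨h0, h1⟩)
  obtain ⟨c, hc, hslope⟩ := exists_hasDerivAt_eq_slope (fun t : ℝ ↦ b (x + t • (y - x)))
    (fun t ↦ fderiv ℝ b (x + t • (y - x)) (y - x)) zero_lt_one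
    (hbc.comp (f := fun t : ℝ ↦ x + t • (y - x)) (by fun_prop) hcl) (fun t ht ↦ by
      have h2 : HasDerivAt (fun σ : ℝ ↦ x + σ • (y - x)) (y - x) t := by
        simpa using ((hasDerivAt_id t).smul_const (y - x)).const_add x
      exact (hbd _ (hxy t ht)).hasFDerivAt.comp_hasDerivAt t h2)
  have hslope' : fderiv ℝ b (x + c • (y - x)) (y - x) = b y - b x := by simpa using hslope
  rw [abs_sub_comm, ← hslope', dist_comm, dist_eq_norm, ← Real.norm_eq_abs]
  exact (ContinuousLinearMap.le_opNorm _ _).trans (by gcongr; exact hbL _ (hxy c hc))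

/-- A function vanishing on the frontier grows at most linearly away from the complement. -/
theorem abs_le_mul_dist_of_notMem {Ω : Set E} (hΩ : IsOpen Ω) {b : E → ℝ} {L : ℝ} (hL : 0 ≤ L)
    (hbc : ContinuousOn b (closure Ω)) (hb0 : ∀ x ∈ frontier Ω, b x = 0)
    (hbd : ∀ x ∈ Ω, DifferentiableAt ℝ b x) (hbL : ∀ x ∈ Ω, ‖fderiv ℝ b x‖ ≤ L)
    {x w : E} (hx : x ∈ closure Ω) (hw : w ∉ Ω) : |b x| ≤ L * dist x w := by
  by_cases hxΩ : x ∈ Ω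
  swap
  · rw [hb0 x (by rw [frontier, hΩ.interior_eq]; exact ⟨hx, hxΩ⟩), abs_zero]
    positivity
  have hγ : Continuous fun t : ℝ ↦ x + t • (w - x) := by fun_prop
  set T : Set ℝ := Icc 0 1 ∩ (fun t : ℝ ↦ x + t • (w - x)) ⁻¹' Ωᶜ
  have hT : IsCompact T := isCompact_Icc.inter_right (hΩ.isClosed_compl.preimage hγ)
  obtain ⟨τ, ⟨⟨hτ0, hτ1⟩, hτΩ⟩, hmin⟩ := hT.exists_isLeast
    ⟨1, ⟨zero_le_one, le_rfl⟩, by simpa using hw⟩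
  have hτpos : 0 < τ := hτ0.lt_of_ne (by rintro rfl; exact hτΩ (by simpa using hxΩ))
  have hbelow : ∀ t ∈ Ico 0 τ, x + t • (w - x) ∈ Ω := by
    intro t ht
    by_contra h
    exact (hmin ⟨⟨ht.1, ht.2.le.trans hτ1⟩, h⟩).not_gt ht.2
  set z := x + τ • (w - x) with hz
  have hzcl : z ∈ closure Ω := by
    have h1 : τ ∈ closure (Ico 0 τ) := by
      rw [closure_Ico hτpos.ne]; exact ⟨hτ0, le_rfl⟩
    exact map_mem_closure (f := fun t : ℝ ↦ x + t • (w - x)) hγ h1 hbelow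
  have hseg : ∀ t ∈ Ioo (0 : ℝ) 1, x + t • (z - x) ∈ Ω := by
    intro t ht
    have := hbelow (t * τ) ⟨mul_nonneg ht.1.le hτ0, by nlinarith [ht.2]⟩
    rwa [mul_smul, ← add_sub_cancel_left x (τ • (w - x)), ← hz] at this
  have key := abs_sub_le_mul_dist_of_openSegment hbc hbd hbL hx hzcl hseg
  rw [hb0 z (by rw [frontier, hΩ.interior_eq]; exact ⟨hzcl, hτΩ⟩), sub_zero] at key
  refine key.trans (mul_le_mul_of_nonneg_left ?_ hL)
  rw [dist_comm, dist_comm x w, dist_eq_norm, dist_eq_norm, hz, add_sub_cancel_left, norm_smul,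
    Real.norm_eq_abs, abs_of_nonneg hτ0]
  exact mul_le_of_le_one_left (norm_nonneg _) hτ1

theorem abs_sub_le_mul_dist {Ω : Set E} (hΩ : IsOpen Ω) {b : E → ℝ} {L : ℝ} (hL : 0 ≤ L)
    (hbc : ContinuousOn b (closure Ω)) (hb0 : ∀ x ∈ frontier Ω, b x = 0)
    (hbd : ∀ x ∈ Ω, DifferentiableAt ℝ b x) (hbL : ∀ x ∈ Ω, ‖fderiv ℝ b x‖ ≤ L)
    {x y : E} (hx : x ∈ closure Ω) (hy : y ∈ closure Ω) : |b x - b y| ≤ L * dist x y := by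
  by_cases hxy : ∀ t ∈ Ioo (0 : ℝ) 1, x + t • (y - x) ∈ Ω
  · exact abs_sub_le_mul_dist_of_openSegment hbc hbd hbL hx hy hxy
  push Not at hxy
  obtain ⟨t, ht, hw⟩ := hxy
  have h1 := abs_le_mul_dist_of_notMem hΩ hL hbc hb0 hbd hbL hx hw
  have h2 := abs_le_mul_dist_of_notMem hΩ hL hbc hb0 hbd hbL hy hw
  have hd : dist x (x + t • (y - x)) + dist y (x + t • (y - x)) = dist x y := by
    have e : y - (x + t • (y - x)) = (1 - t) • (y - x) := by
      rw [sub_smul, one_smul]; abel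
    rw [dist_comm x, dist_comm x y, dist_eq_norm, dist_eq_norm, dist_eq_norm, e,
      add_sub_cancel_left, norm_smul, norm_smul, Real.norm_eq_abs, Real.norm_eq_abs,
      abs_of_pos ht.1, abs_of_pos (sub_pos.2 ht.2)]
    ring
  calc |b x - b y| ≤ |b x| + |b y| := abs_sub _ _
    _ ≤ _ := by rw [← hd, mul_add]; exact add_le_add h1 h2

theorem ctNorm_nonneg (t : ℝ) (s : Set E) (f : E → ℝ) : 0 ≤ ctNorm t s f :=
  le_max_of_le_left (Real.sSup_nonneg (by rintro _ ⟨i, -, x, -, rfl⟩; exact norm_nonneg _))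

theorem MemCt.norm_iteratedFDerivWithin_le {t : ℝ} {s : Set E} {f : E → ℝ} (hf : MemCt t s f)
    {i : ℕ} (hi : (i : ℝ) ≤ t) {x : E} (hx : x ∈ s) :
    ‖iteratedFDerivWithin ℝ i f s x‖ ≤ ctNorm t s f := by
  obtain ⟨C, hC⟩ := hf.2.1
  refine le_max_of_le_left (le_csSup ⟨C, ?_⟩ ⟨i, hi, x, hx, rfl⟩)
  rintro _ ⟨i, hi, x, hx, rfl⟩
  exact hC i hi x hx

theorem MemCt.abs_le {t : ℝ} {s : Set E} {f : E → ℝ} (hf : MemCt t s f) (ht : 0 ≤ t)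
    {x : E} (hx : x ∈ s) : |f x| ≤ ctNorm t s f := by
  simpa using hf.norm_iteratedFDerivWithin_le (i := 0) (by simpa using ht) hx

theorem MemCt.norm_iteratedFDeriv_le {t : ℝ} {Ω : Set E} (hΩ : IsOpen Ω) {f : E → ℝ}
    (hf : MemCt t (closure Ω) f) {i : ℕ} (hi : (i : ℝ) ≤ t) {x : E} (hx : x ∈ Ω) :
    ‖iteratedFDeriv ℝ i f x‖ ≤ ctNorm t (closure Ω) f := by
  have h := hf.norm_iteratedFDerivWithin_le hi (subset_closure hx)
  have hev : closure Ω =ᶠ[nhds x] univ :=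
    Filter.eventuallyEq_univ.2 (Filter.mem_of_superset (hΩ.mem_nhds hx) subset_closure)
  rwa [iteratedFDerivWithin_congr_set hev, iteratedFDerivWithin_univ] at h

theorem norm_iteratedFDerivWithin_sub_of_eq_zero {n : ℕ} (hn : n = 0) (s : Set E) (f : E → ℝ)
    (x y : E) :
    ‖iteratedFDerivWithin ℝ n f s x - iteratedFDerivWithin ℝ n f s y‖ = |f x - f y| := by
  subst hn
  rw [iteratedFDerivWithin_zero_eq_comp, Function.comp_apply, Function.comp_apply, ← map_sub,
    LinearIsometryEquiv.norm_map, Real.norm_eq_abs]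

theorem memCt_of_lt_one {t C : ℝ} (ht1 : t < 1) {s : Set E} {f : E → ℝ}
    (hc : ContinuousOn f s) (hb : ∀ x ∈ s, |f x| ≤ C)
    (hh : ∀ x ∈ s, ∀ y ∈ s, |f x - f y| ≤ C * ‖x - y‖ ^ t) : MemCt t s f := by
  have hfl : ⌊t⌋₊ = 0 := Nat.floor_eq_zero.2 ht1
  simp only [MemCt, norm_iteratedFDerivWithin_sub_of_eq_zero hfl, hfl, Nat.cast_zero, sub_zero]
  refine ⟨contDiffOn_zero.2 hc, ⟨C, fun i hi x hx ↦ ?_⟩, C, hh⟩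
  obtain rfl : i = 0 := Nat.lt_one_iff.1 (by exact_mod_cast hi.trans_lt ht1)
  simpa using hb x hx

theorem ctNorm_le_of_lt_one {t C : ℝ} (ht1 : t < 1) (hC : 0 ≤ C) {s : Set E} {f : E → ℝ}
    (hb : ∀ x ∈ s, |f x| ≤ C) (hh : ∀ x ∈ s, ∀ y ∈ s, |f x - f y| ≤ C * ‖x - y‖ ^ t) :
    ctNorm t s f ≤ C := by
  have hfl : ⌊t⌋₊ = 0 := Nat.floor_eq_zero.2 ht1
  simp only [ctNorm, norm_iteratedFDerivWithin_sub_of_eq_zero hfl, hfl, Nat.cast_zero, sub_zero]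
  refine max_le (Real.sSup_le ?_ hC) (Real.sSup_le ?_ hC)
  · rintro _ ⟨i, hi, x, hx, rfl⟩
    obtain rfl : i = 0 := Nat.lt_one_iff.1 (by exact_mod_cast hi.trans_lt ht1)
    simpa using hb x hx
  · rintro _ ⟨x, hx, y, hy, hxy, rfl⟩
    have : 0 < ‖x - y‖ := norm_pos_iff.2 (sub_ne_zero.2 hxy)
    rw [div_le_iff₀ (by positivity)]
    exact hh x hx y hy

theorem memCtTilde_zero (t : ℝ) (Ω : Set E) : MemCtTilde t Ω (fun _ ↦ (0 : ℝ)) := by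
  refine ⟨⟨contDiffOn_const, ⟨0, fun i _ x _ ↦ ?_⟩, 0, fun x _ y _ ↦ ?_⟩, fun _ _ ↦ rfl⟩ <;>
  simp [show (fun _ : E ↦ (0 : ℝ)) = 0 from rfl]

/-- The gradients of the smooth parts of dyadic decompositions of a function grow at most
geometrically, by telescoping. -/
theorem norm_fderiv_le_of_dyadic_decomposition {Ω : Set E} (hΩ : IsOpen Ω) {n : ℕ} {C θ M : ℝ}
    (hC : 0 < C) (hθ : 1 < 2 * θ) (hM : 0 ≤ M)
    (hCg : ∀ (g : E → ℝ) (A B h : ℝ), ContDiffOn ℝ (n + 1 : ℕ) g Ω → (∀ x ∈ Ω, |g x| ≤ A) →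
      (∀ x ∈ Ω, ‖iteratedFDeriv ℝ (n + 1) g x‖ ≤ B) → 0 < h → h ≤ 1 →
      ∀ x ∈ Ω, ‖fderiv ℝ g x‖ ≤ C * (A / h + h ^ n * B))
    (hθ1 : θ ≤ 1) {f : E → ℝ} {a b : ℕ → E → ℝ} (hab : ∀ j, ∀ x ∈ Ω, f x = a j x + b j x)
    (ha : ∀ j, ∀ x ∈ Ω, |a j x| ≤ M * θ ^ j) (hb : ∀ j, ContDiffOn ℝ (n + 1 : ℕ) (b j) Ω)
    (hbD : ∀ j, ∀ x ∈ Ω, ‖iteratedFDeriv ℝ (n + 1) (b j) x‖ ≤ M * (θ * 2 ^ (n + 1)) ^ j)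
    (hb0 : ∀ x ∈ Ω, ‖fderiv ℝ (b 0) x‖ ≤ M) (j : ℕ) {x : E} (hx : x ∈ Ω) :
    ‖fderiv ℝ (b j) x‖ ≤
      (1 + C * (3 + θ * 2 ^ (n + 1)) / (2 * θ - 1)) * M * (2 * θ) ^ j := by
  have hθ0 : 0 < θ := by linarith
  have hq : 0 < 2 * θ - 1 := by linarith
  set C' : ℝ := C * (3 + θ * 2 ^ (n + 1)) with hC'
  have hC'0 : 0 < C' := by positivity
  induction j with
  | zero =>
    refine (hb0 x hx).trans ?_
    rw [pow_zero, mul_one]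
    exact le_mul_of_one_le_left hM (le_add_of_nonneg_right (by positivity))
  | succ j ih =>
    have hsub := hCg (b (j + 1) - b j) (2 * M * θ ^ j)
      (M * (θ * 2 ^ (n + 1)) ^ j * (1 + θ * 2 ^ (n + 1))) ((1 / 2) ^ j) ((hb (j + 1)).sub (hb j))
      (fun y hy ↦ by
        have e : (b (j + 1) - b j) y = a j y - a (j + 1) y := by
          have := hab j y hy
          have := hab (j + 1) y hy
          rw [Pi.sub_apply]; linarith
        rw [e]
        have h3 : M * θ ^ (j + 1) ≤ M * θ ^ j :=
          mul_le_mul_of_nonneg_left (pow_le_pow_of_le_one hθ0.le hθ1 j.le_succ) hM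
        linarith [abs_sub (a j y) (a (j + 1) y), ha j y hy, ha (j + 1) y hy])
      (fun y hy ↦ by
        have hnh := hΩ.mem_nhds hy
        rw [iteratedFDeriv_sub_apply ((hb (j + 1)).contDiffAt hnh) ((hb j).contDiffAt hnh)]
        refine (norm_sub_le _ _).trans ((add_le_add (hbD (j + 1) y hy) (hbD j y hy)).trans ?_)
        rw [pow_succ]
        exact le_of_eq (by ring))
      (by positivity) (pow_le_one₀ (by norm_num) (by norm_num)) x hx
    have e : C * (2 * M * θ ^ j / (1 / 2) ^ j + ((1 / 2) ^ j) ^ n *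
        (M * (θ * 2 ^ (n + 1)) ^ j * (1 + θ * 2 ^ (n + 1)))) = C' * M * (2 * θ) ^ j := by
      have e1 : ((1 / 2 : ℝ) ^ j) ^ n * (θ * 2 ^ (n + 1)) ^ j = (2 * θ) ^ j := by
        rw [← pow_mul, mul_comm j n, pow_mul, ← mul_pow]
        congr 1
        rw [pow_succ, one_div, inv_pow]
        field_simp
      have e2 : 2 * M * θ ^ j / (1 / 2) ^ j = 2 * M * (2 * θ) ^ j := by
        rw [one_div, inv_pow, mul_pow]
        field_simp
      rw [e2, hC', show ∀ p q r s : ℝ, p * (q * r * s) = q * s * (p * r) by intros; ring, e1]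
      ring
    rw [e] at hsub
    have hd : ∀ i, DifferentiableAt ℝ (b i) x := fun i ↦
      ((hb i).contDiffAt (hΩ.mem_nhds hx)).differentiableAt (by simp)
    rw [fderiv_sub (hd _) (hd _)] at hsub
    calc ‖fderiv ℝ (b (j + 1)) x‖
        ≤ ‖fderiv ℝ (b j) x‖ + ‖fderiv ℝ (b (j + 1)) x - fderiv ℝ (b j) x‖ :=
          norm_le_norm_add_norm_sub' _ _
      _ ≤ (1 + C' / (2 * θ - 1)) * M * (2 * θ) ^ j + C' * M * (2 * θ) ^ j := add_le_add ih hsub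
      _ = (1 + C' / (2 * θ - 1) + C') * (M * (2 * θ) ^ j) := by ring
      _ ≤ (1 + C' / (2 * θ - 1)) * (2 * θ) * (M * (2 * θ) ^ j) := by
          refine mul_le_mul_of_nonneg_right ?_ (by positivity)
          have : C' / (2 * θ - 1) * (2 * θ - 1) = C' := div_mul_cancel₀ _ hq.ne'
          linarith
      _ = _ := by rw [pow_succ]; ring

theorem exists_decomposition_of_kFunctional_lt {s t₀ t₁ r : ℝ} {Ω : Set E} {f : E → ℝ}
    (hf : MemCtTilde t₀ Ω f) (h : kFunctional s t₀ t₁ Ω f < r) :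
    ∃ f₀ f₁ : E → ℝ, (∀ x ∈ closure Ω, f x = f₀ x + f₁ x) ∧ MemCtTilde t₀ Ω f₀ ∧
      MemCtTilde t₁ Ω f₁ ∧ ctNorm t₀ (closure Ω) f₀ + s * ctNorm t₁ (closure Ω) f₁ < r := by
  rw [kFunctional] at h
  obtain ⟨_, ⟨f₀, f₁, hadd, h₀, h₁, rfl⟩, hlt⟩ := exists_lt_of_csInf_lt
    (by exact ⟨_, f, fun _ ↦ 0, fun x _ ↦ by simp, hf, memCtTilde_zero t₁ Ω, rfl⟩) h
  exact ⟨f₀, f₁, hadd, h₀, h₁, hlt⟩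

theorem memCtTilde_of_continuousOn {Ω : Set E} (hc : IsCompact (closure Ω)) {f : E → ℝ}
    (hf : ContinuousOn f (closure Ω)) (hf0 : ∀ x ∈ frontier Ω, f x = 0) : MemCtTilde 0 Ω f := by
  obtain ⟨C, hC⟩ := hc.exists_bound_of_continuousOn hf
  refine ⟨memCt_of_lt_one (C := 2 * C) one_pos hf (fun x hx ↦ ?_) (fun x hx y hy ↦ ?_), hf0⟩
  · linarith [hC x hx, (norm_nonneg _).trans (hC x hx), Real.norm_eq_abs (f x)]
  · rw [Real.rpow_zero, mul_one, ← Real.norm_eq_abs]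
    linarith [norm_sub_le (f x) (f y), hC x hx, hC y hy]

theorem exists_holder_bound_of_kFunctional_lt [ProperSpace E] {Ω : Set E} (hΩ : IsOpen Ω)
    (hb : Bornology.IsBounded Ω) (hs : HasSmoothBoundary Ω) (n : ℕ) {α : ℝ} (hα : 0 < α)
    (hαn : α * (n + 1 : ℕ) < 1) :
    ∃ K > 0, ∀ (f : E → ℝ) (M : ℝ), 0 ≤ M → ContinuousOn f (closure Ω) →
      (∀ x ∈ frontier Ω, f x = 0) →
      (∀ s : ℝ, 0 < s → kFunctional s 0 (n + 1 : ℕ) Ω f < M * s ^ α) →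
      (∀ x ∈ closure Ω, |f x| ≤ K * M) ∧ ∀ x ∈ closure Ω, ∀ y ∈ closure Ω,
        |f x - f y| ≤ K * M * ‖x - y‖ ^ (α * (n + 1 : ℕ)) := by
  obtain ⟨C, hC, hCg⟩ := exists_norm_fderiv_le hΩ hb hs n
  set β : ℝ := α * (n + 1 : ℕ) with hβ
  have hβ0 : 0 < β := by positivity
  set θ : ℝ := (1 / 2 : ℝ) ^ β with hθ
  have hθ0 : 0 < θ := by positivity
  have hθ1 : θ ≤ 1 := Real.rpow_le_one (by norm_num) (by norm_num) hβ0.le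
  have hθ2 : 1 < 2 * θ := by
    have : (1 / 2 : ℝ) ^ (1 : ℝ) < θ :=
      Real.rpow_lt_rpow_of_exponent_gt (by norm_num) (by norm_num) hαn
    rw [Real.rpow_one] at this
    linarith
  have hq : 0 < 2 * θ - 1 := by linarith
  set C₁ : ℝ := 1 + C * (3 + θ * 2 ^ (n + 1)) / (2 * θ - 1) with hC₁
  have hC₁0 : 0 < C₁ := by positivity
  refine ⟨4 + 2 * C₁, by positivity, fun f M hM hf hf0 hK ↦ ?_⟩
  have hf' := memCtTilde_of_continuousOn hb.isCompact_closure hf hf0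
  set σ : ℕ → ℝ := fun j ↦ ((1 / 2) ^ (n + 1)) ^ j with hσ
  have hσ0 : ∀ j, 0 < σ j := fun j ↦ by positivity
  have hσα : ∀ j, σ j ^ α = θ ^ j := by
    intro j
    simp only [hσ, hθ]
    rw [← Real.rpow_natCast, ← Real.rpow_natCast, ← Real.rpow_natCast,
      ← Real.rpow_mul (by positivity), ← Real.rpow_mul (by positivity),
      ← Real.rpow_mul (by positivity)]
    congr 1
    rw [hβ]; ring
  choose a b hab ha hb' hlt using fun j ↦
    exists_decomposition_of_kFunctional_lt hf' (hK (σ j) (hσ0 j))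
  have hna : ∀ j, ctNorm 0 (closure Ω) (a j) ≤ M * θ ^ j := fun j ↦ by
    have := mul_nonneg (hσ0 j).le (ctNorm_nonneg ((n + 1 : ℕ) : ℝ) (closure Ω) (b j))
    rw [← hσα]
    linarith [hlt j]
  have hnb : ∀ j, ctNorm (n + 1 : ℕ) (closure Ω) (b j) ≤ M * (θ * 2 ^ (n + 1)) ^ j := fun j ↦ by
    have h1 : σ j * ctNorm (n + 1 : ℕ) (closure Ω) (b j) ≤ M * θ ^ j := by
      rw [← hσα]
      linarith [hlt j, ctNorm_nonneg 0 (closure Ω) (a j)]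
    have h2 : M * θ ^ j = σ j * (M * (θ * 2 ^ (n + 1)) ^ j) := by
      have : σ j * (2 ^ (n + 1)) ^ j = 1 := by
        simp only [hσ]
        rw [← mul_pow, ← mul_pow]
        norm_num
      rw [mul_pow]
      linear_combination (-M * θ ^ j) * this
    rw [h2] at h1
    exact le_of_mul_le_mul_left h1 (hσ0 j)
  have haM : ∀ j, ∀ x ∈ closure Ω, |a j x| ≤ M * θ ^ j := fun j x hx ↦
    ((ha j).1.abs_le le_rfl hx).trans (hna j)
  have hbΩ : ∀ j, ContDiffOn ℝ (n + 1 : ℕ) (b j) Ω := fun j ↦ by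
    have := (hb' j).1.1
    rw [Nat.floor_natCast] at this
    exact this.mono subset_closure
  have hgrad : ∀ j, ∀ x ∈ Ω, ‖fderiv ℝ (b j) x‖ ≤ C₁ * M * (2 * θ) ^ j := fun j x hx ↦ by
    refine norm_fderiv_le_of_dyadic_decomposition hΩ hC hθ2 hM hCg hθ1 (f := f) (a := a)
      (fun j x hx ↦ hab j x (subset_closure hx)) (fun j x hx ↦ haM j x (subset_closure hx)) hbΩ
      (fun j x hx ↦ ((hb' j).1.norm_iteratedFDeriv_le hΩ le_rfl hx).trans (hnb j))
      (fun x hx ↦ ?_) j hx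
    have := ((hb' 0).1.norm_iteratedFDeriv_le hΩ (i := 1) (by simp) hx).trans (hnb 0)
    rwa [norm_iteratedFDeriv_one, pow_zero, mul_one] at this
  have hsup : ∀ x ∈ closure Ω, |f x| ≤ 2 * M := fun x hx ↦ by
    have h1 := haM 0 x hx
    have h2 := ((hb' 0).1.abs_le (Nat.cast_nonneg _) hx).trans (hnb 0)
    rw [pow_zero, mul_one] at h1 h2
    rw [hab 0 x hx]
    linarith [abs_add_le (a 0 x) (b 0 x)]
  have hKM : 4 * M ≤ (4 + 2 * C₁) * M := by gcongr; linarith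
  refine ⟨fun x hx ↦ (hsup x hx).trans (by linarith), fun x hx y hy ↦ ?_⟩
  rcases eq_or_ne x y with rfl | hxy
  · rw [sub_self, abs_zero]
    positivity
  have hd : 0 < ‖x - y‖ := norm_pos_iff.2 (sub_ne_zero.2 hxy)
  rcases le_or_gt ‖x - y‖ 1 with hd1 | hd1
  · obtain ⟨j, hj1, hj2⟩ := exists_nat_pow_near_of_lt_one hd hd1 (y := (1 / 2 : ℝ))
      (by norm_num) (by norm_num)
    have hbj : |b j x - b j y| ≤ C₁ * M * (2 * θ) ^ j * dist x y := by
      refine abs_sub_le_mul_dist hΩ (by positivity) (hb' j).1.1.continuousOn (hb' j).2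
        (fun z hz ↦ ?_) (hgrad j) hx hy
      exact ((hbΩ j).contDiffAt (hΩ.mem_nhds hz)).differentiableAt (by simp)
    have hbj' : |b j x - b j y| ≤ C₁ * M * θ ^ j := by
      refine hbj.trans ?_
      rw [dist_eq_norm]
      calc _ ≤ C₁ * M * (2 * θ) ^ j * (1 / 2) ^ j := by gcongr
        _ = C₁ * M * θ ^ j := by
          rw [mul_assoc _ ((2 * θ) ^ j), ← mul_pow, show 2 * θ * (1 / 2) = θ by ring]
    have hθj : θ ^ (j + 1) ≤ ‖x - y‖ ^ β := by
      rw [hθ, ← Real.rpow_natCast, ← Real.rpow_mul (by norm_num), mul_comm,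
        Real.rpow_mul (by norm_num), Real.rpow_natCast]
      gcongr
    have hθj' : θ ^ j ≤ 2 * ‖x - y‖ ^ β := by
      have : θ ^ j ≤ 2 * θ ^ (j + 1) := by
        rw [pow_succ]
        nlinarith [pow_pos hθ0 j]
      linarith
    calc |f x - f y| = |(a j x - a j y) + (b j x - b j y)| := by
          rw [hab j x hx, hab j y hy]; congr 1; ring
      _ ≤ |a j x| + |a j y| + |b j x - b j y| :=
          (abs_add_le _ _).trans (by gcongr; exact abs_sub _ _)
      _ ≤ (2 + C₁) * M * θ ^ j := by linarith [haM j x hx, haM j y hy]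
      _ ≤ (2 + C₁) * M * (2 * ‖x - y‖ ^ β) := by gcongr
      _ = _ := by ring
  · have h1 : 1 ≤ ‖x - y‖ ^ β := Real.one_le_rpow hd1.le hβ0.le
    calc |f x - f y| ≤ |f x| + |f y| := abs_sub _ _
      _ ≤ (4 + 2 * C₁) * M := by linarith [hsup x hx, hsup y hy]
      _ ≤ _ := le_mul_of_one_le_right (by positivity) h1

theorem kFunctional_nonneg {s : ℝ} (hs : 0 ≤ s) (t₀ t₁ : ℝ) (Ω : Set E) (f : E → ℝ) :
    0 ≤ kFunctional s t₀ t₁ Ω f := by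
  refine Real.sInf_nonneg ?_
  rintro _ ⟨f₀, f₁, -, -, -, rfl⟩
  have := ctNorm_nonneg t₀ (closure Ω) f₀
  have := ctNorm_nonneg t₁ (closure Ω) f₁
  positivity

end

/-- For a bounded open `Ω ⊆ ℝ^m` with smooth boundary, an integer `k ≥ 1` and
`α ∈ (0,1)` with `αk < 1`, one has `(C̃^0(cl Ω), C̃^k(cl Ω))_{α,∞} ⊆ C̃^{αk}(cl Ω)` continuously:
any continuous `f` on `cl Ω` vanishing on `∂Ω` whose interpolation norm
`N = sup_{s>0} s^{-α} K(s, f; C̃^0, C̃^k)` is finite belongs to `C̃^{αk}(cl Ω)` with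
`‖f‖_{C^{αk}} ≤ C N`. -/
theorem holder_of_interpolation (m : ℕ) (Ω : Set (EuclideanSpace ℝ (Fin m)))
    (hΩopen : IsOpen Ω) (hΩbdd : Bornology.IsBounded Ω) (hΩsmooth : HasSmoothBoundary Ω)
    (k : ℕ) (hk : 1 ≤ k) (α : ℝ) (hα : α ∈ Ioo (0:ℝ) 1) (hαk : α * k < 1) :
    ∃ C > 0, ∀ f : EuclideanSpace ℝ (Fin m) → ℝ,
      ContinuousOn f (closure Ω) → (∀ x ∈ frontier Ω, f x = 0) →
      ∀ N : ℝ, (∀ s : ℝ, 0 < s → s ^ (-α) * kFunctional s 0 (k : ℝ) Ω f ≤ N) →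
        MemCtTilde (α * k) Ω f ∧ ctNorm (α * k) (closure Ω) f ≤ C * N := by
  obtain ⟨n, rfl⟩ := Nat.exists_eq_succ_of_ne_zero (Nat.one_le_iff_ne_zero.1 hk)
  obtain ⟨K, hK, H⟩ := exists_holder_bound_of_kFunctional_lt hΩopen hΩbdd hΩsmooth n hα.1 hαk
  refine ⟨K, hK, fun f hf hf0 N hN ↦ ?_⟩
  have hN0 : 0 ≤ N := by
    have := hN 1 one_pos
    rw [Real.one_rpow, one_mul] at this
    exact (kFunctional_nonneg zero_le_one _ _ _ _).trans this
  have hM : ∀ M, N < M → _ := fun M hNM ↦ H f M (hN0.trans hNM.le) hf hf0 fun s hs ↦ by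
    have h1 := (hN s hs).trans_lt hNM
    rwa [Real.rpow_neg hs.le, inv_mul_lt_iff₀ (by positivity), mul_comm] at h1
  obtain ⟨h1, h2⟩ := hM (N + 1) (lt_add_one N)
  refine ⟨⟨memCt_of_lt_one hαk hf h1 h2, hf0⟩, le_of_forall_pos_le_add fun ε hε ↦ ?_⟩
  obtain ⟨h3, h4⟩ := hM (N + ε / K) (lt_add_of_pos_right N (by positivity))
  have := ctNorm_le_of_lt_one hαk (by positivity) h3 h4
  rwa [mul_add, mul_div_cancel₀ _ hK.ne'] at this

end
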